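/- Fix τ in the complex upper half-plane and a real number y₀ with 0 < y₀ < Im τ, and assume θ₁(x + i y₀ | τ) ≠ 0 for all x ∈ [0,1]. Then the a-cycle integral of the squared logarithmic derivative of θ₁ satisfies ∫₀¹ ( θ₁'(x + i y₀ | τ) / θ₁(x + i y₀ | τ) )² dx = θ₁'''(0|τ)/(3 θ₁'(0|τ)) − 2π²/3. -/

import Mathlib

open Complex Real

/-- Jacobi theta function θ₁(z|τ). -/
noncomputable def theta1 (τ z : ℂ) : ℂ :=
  -Complex.I * ∑' n : ℤ, (-1 : ℂ) ^ n *
    Complex.exp ((π : ℂ) * Complex.I * τ * ((n : ℂ) + 1 / 2) ^ 2) *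
    Complex.exp ((2 * (n : ℂ) + 1) * (π : ℂ) * Complex.I * z)

/-- θ₁'(z|τ), the derivative of θ₁ with respect to z. -/
noncomputable def theta1' (τ z : ℂ) : ℂ := deriv (theta1 τ) z

open Set Filter Topology

/-! ### Elementary properties of `theta1` -/

lemma theta1_eq_jacobiTheta₂ (τ z : ℂ) :
    theta1 τ z = -I * cexp (π * I * τ / 4) * cexp (π * I * z) *
      jacobiTheta₂ (z + (1 / 2 + τ / 2)) τ := by
  rw [theta1, jacobiTheta₂, mul_assoc (-I), mul_assoc (-I)]
  congr 1
  simp only [← tsum_mul_left]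
  refine tsum_congr fun n ↦ ?_
  have h : (-1 : ℂ) ^ n = cexp (π * I * n) := by
    rw [← Complex.exp_pi_mul_I, ← Complex.exp_int_mul]
    ring_nf
  rw [h, jacobiTheta₂_term]
  simp only [← Complex.exp_add]
  congr 1
  ring

lemma differentiable_theta1 {τ : ℂ} (hτ : 0 < τ.im) : Differentiable ℂ (theta1 τ) := by
  have h : theta1 τ = fun z ↦ -I * cexp (π * I * τ / 4) * cexp (π * I * z) *
      jacobiTheta₂ (z + (1 / 2 + τ / 2)) τ := funext (theta1_eq_jacobiTheta₂ τ)
  rw [h]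
  intro z
  have h2 : DifferentiableAt ℂ (fun z ↦ jacobiTheta₂ (z + (1 / 2 + τ / 2)) τ) z :=
    (differentiableAt_jacobiTheta₂_fst (z + (1 / 2 + τ / 2)) hτ).comp z
      (differentiableAt_id.add_const _)
  fun_prop

lemma theta1_add_one (τ z : ℂ) : theta1 τ (z + 1) = -theta1 τ z := by
  rw [theta1_eq_jacobiTheta₂, theta1_eq_jacobiTheta₂, add_right_comm, jacobiTheta₂_add_left,
    mul_add, Complex.exp_add, mul_one, Complex.exp_pi_mul_I]
  ring

lemma theta1_add_self (τ z : ℂ) :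
    theta1 τ (z + τ) = -cexp (-(π * I * (τ + 2 * z))) * theta1 τ z := by
  rw [theta1_eq_jacobiTheta₂, theta1_eq_jacobiTheta₂, add_right_comm, jacobiTheta₂_add_left',
    show cexp (-π * I * (τ + 2 * (z + (1 / 2 + τ / 2)))) =
      cexp (-(π * I * (τ + 2 * z))) * cexp (-(π * I * τ)) * cexp (-(π * I)) by
      rw [← Complex.exp_add, ← Complex.exp_add]; congr 1; ring,
    Complex.exp_neg (π * I), Complex.exp_pi_mul_I, mul_add (π * I), Complex.exp_add (π * I * z),
    Complex.exp_neg (π * I * τ)]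
  have := Complex.exp_ne_zero (π * I * τ)
  field_simp

lemma theta1_neg (τ z : ℂ) : theta1 τ (-z) = -theta1 τ z := by
  have h : -z + (1 / 2 + τ / 2) = -(z + (1 / 2 + τ / 2)) + τ + 1 := by ring
  rw [theta1_eq_jacobiTheta₂, theta1_eq_jacobiTheta₂, h, jacobiTheta₂_add_left,
    jacobiTheta₂_add_left', jacobiTheta₂_neg_left,
    show cexp (-π * I * (τ + 2 * -(z + (1 / 2 + τ / 2)))) =
      cexp (π * I * z) * cexp (π * I * z) * cexp (π * I) by
      rw [← Complex.exp_add, ← Complex.exp_add]; congr 1; ring,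
    Complex.exp_pi_mul_I, mul_neg, Complex.exp_neg]
  have := Complex.exp_ne_zero (π * I * z)
  field_simp

/-! ### The infinite product -/

/-- The `q`-Pochhammer symbol `(q w; q)_∞ = ∏_{n ≥ 1} (1 - qⁿ w)`. -/
noncomputable def qProd (q w : ℂ) : ℂ := ∏' n : ℕ, (1 + -(q ^ (n + 1) * w))

lemma summable_norm_pow_succ_mul {q : ℂ} (hq : ‖q‖ < 1) (w : ℂ) :
    Summable fun n : ℕ ↦ ‖-(q ^ (n + 1) * w)‖ := by
  simpa using ((summable_nat_add_iff 1).mpr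
    (summable_geometric_of_lt_one (norm_nonneg q) hq)).mul_right ‖w‖

lemma differentiable_qProd {q : ℂ} (hq : ‖q‖ < 1) : Differentiable ℂ (qProd q) := by
  intro w
  have h : HasProdLocallyUniformlyOn (fun (n : ℕ) (w : ℂ) ↦ 1 + -(q ^ (n + 1) * w)) (qProd q)
      (Metric.ball 0 (‖w‖ + 1)) := by
    refine Summable.hasProdLocallyUniformlyOn_nat_one_add Metric.isOpen_ball
      (u := fun n ↦ ‖q‖ ^ (n + 1) * (‖w‖ + 1)) ?_ (.of_forall fun n x hx ↦ ?_) fun n ↦ by fun_prop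
    · exact ((summable_nat_add_iff 1).mpr
        (summable_geometric_of_lt_one (norm_nonneg q) hq)).mul_right _
    · rw [norm_neg, norm_mul, norm_pow]
      have : ‖x‖ < ‖w‖ + 1 := by simpa using hx
      gcongr
  have h' : DifferentiableOn ℂ (qProd q) (Metric.ball 0 (‖w‖ + 1)) :=
    TendstoLocallyUniformlyOn.differentiableOn h
      (.of_forall fun _ ↦ by
        simpa [Finset.prod_fn] using DifferentiableOn.finsetProd (fun _ _ ↦ by fun_prop))
      Metric.isOpen_ball
  exact h'.differentiableAt (Metric.isOpen_ball.mem_nhds (by simp))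

lemma qProd_ne_zero {q w : ℂ} (hq : ‖q‖ < 1) (hw : ‖q * w‖ < 1) : qProd q w ≠ 0 := by
  refine tprod_one_add_ne_zero_of_summable (fun n h ↦ ?_) (summable_norm_pow_succ_mul hq w)
  have h1 : q ^ n * (q * w) = 1 := by linear_combination -h
  have h2 : ‖q ^ n * (q * w)‖ < 1 := by
    rw [norm_mul, norm_pow]
    exact mul_lt_one_of_nonneg_of_lt_one_right (pow_le_one₀ (norm_nonneg _) hq.le)
      (norm_nonneg _) hw
  rw [h1] at h2
  simp at h2

lemma qProd_eq_mul {q : ℂ} (hq : ‖q‖ < 1) (w : ℂ) :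
    qProd q w = (1 - q * w) * qProd q (q * w) := by
  have e (n : ℕ) : 1 + -(q ^ (n + 1 + 1) * w) = 1 + -(q ^ (n + 1) * (q * w)) := by ring
  have h : Multipliable fun n : ℕ ↦ 1 + -(q ^ (n + 1 + 1) * w) := by
    simp only [e]
    exact multipliable_one_add_of_summable (summable_norm_pow_succ_mul hq (q * w))
  rw [qProd, tprod_eq_zero_mul' (f := fun n : ℕ ↦ 1 + -(q ^ (n + 1) * w)) h, qProd]
  simp only [e, zero_add, pow_one, sub_eq_add_neg]

/-- The factor `∏_{n ≥ 1} (1 - qⁿ e^{2πiz}) (1 - qⁿ e^{-2πiz})` of `θ₁(z|τ)`, where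
`q = e^{2πiτ}`. -/
noncomputable def thetaFactor (τ z : ℂ) : ℂ :=
  qProd (cexp (2 * π * I * τ)) (cexp (2 * π * I * z)) *
    qProd (cexp (2 * π * I * τ)) (cexp (-(2 * π * I * z)))

lemma norm_cexp_two_pi_I_mul_lt_one {z : ℂ} (hz : 0 < z.im) : ‖cexp (2 * π * I * z)‖ < 1 := by
  rw [Complex.norm_exp, Real.exp_lt_one_iff]
  simp
  positivity

lemma differentiable_thetaFactor {τ : ℂ} (hτ : 0 < τ.im) : Differentiable ℂ (thetaFactor τ) := by
  have h := differentiable_qProd (norm_cexp_two_pi_I_mul_lt_one hτ)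
  unfold thetaFactor
  fun_prop

lemma thetaFactor_neg (τ z : ℂ) : thetaFactor τ (-z) = thetaFactor τ z := by
  simp [thetaFactor, mul_comm]

lemma thetaFactor_add_one (τ z : ℂ) : thetaFactor τ (z + 1) = thetaFactor τ z := by
  simp [thetaFactor, mul_add, Complex.exp_add, Complex.exp_neg, Complex.exp_two_pi_mul_I]

lemma thetaFactor_ne_zero {τ z : ℂ} (hz : |z.im| < τ.im) : thetaFactor τ z ≠ 0 := by
  have hτ : 0 < τ.im := (abs_nonneg _).trans_lt hz
  rw [abs_lt] at hz
  refine mul_ne_zero (qProd_ne_zero (norm_cexp_two_pi_I_mul_lt_one hτ) ?_)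
    (qProd_ne_zero (norm_cexp_two_pi_I_mul_lt_one hτ) ?_)
  · rw [← Complex.exp_add, ← mul_add]
    exact norm_cexp_two_pi_I_mul_lt_one (by rw [add_im]; linarith)
  · rw [← Complex.exp_add, ← sub_eq_add_neg, ← mul_sub]
    exact norm_cexp_two_pi_I_mul_lt_one (by rw [sub_im]; linarith)

lemma sin_mul_thetaFactor_add_self {τ : ℂ} (hτ : 0 < τ.im) (z : ℂ) :
    Complex.sin (π * (z + τ)) * thetaFactor τ (z + τ) =
      -cexp (-(π * I * (τ + 2 * z))) * (Complex.sin (π * z) * thetaFactor τ z) := by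
  have hq := norm_cexp_two_pi_I_mul_lt_one hτ
  have h1 := qProd_eq_mul hq (cexp (2 * π * I * z))
  have h2 := qProd_eq_mul hq (cexp (-(2 * π * I * (z + τ))))
  have e1 : cexp (2 * π * I * τ) * cexp (2 * π * I * z) = cexp (2 * π * I * (z + τ)) := by
    rw [← Complex.exp_add]; ring_nf
  have e2 : cexp (2 * π * I * τ) * cexp (-(2 * π * I * (z + τ))) = cexp (-(2 * π * I * z)) := by
    rw [← Complex.exp_add]; ring_nf
  rw [e1] at h1
  rw [e2] at h2
  rw [thetaFactor, thetaFactor, h1, h2]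
  have key : Complex.sin (π * (z + τ)) * (1 - cexp (-(2 * π * I * z))) =
      -cexp (-(π * I * (τ + 2 * z))) * (Complex.sin (π * z) * (1 - cexp (2 * π * I * (z + τ)))) := by
    have hz := Complex.exp_ne_zero (π * I * z)
    have ht := Complex.exp_ne_zero (π * I * τ)
    have a1 : cexp (-(2 * π * I * z)) = (cexp (π * I * z))⁻¹ ^ 2 := by
      rw [← Complex.exp_neg, ← Complex.exp_nat_mul]; congr 1; push_cast; ring
    have a2 : cexp (2 * π * I * (z + τ)) = cexp (π * I * z) ^ 2 * cexp (π * I * τ) ^ 2 := by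
      rw [← Complex.exp_nat_mul, ← Complex.exp_nat_mul, ← Complex.exp_add]
      congr 1; push_cast; ring
    have a3 : cexp (-(π * I * (τ + 2 * z))) = (cexp (π * I * z))⁻¹ ^ 2 * (cexp (π * I * τ))⁻¹ := by
      rw [← Complex.exp_neg, ← Complex.exp_neg, ← Complex.exp_nat_mul, ← Complex.exp_add]
      congr 1; push_cast; ring
    have a4 : Complex.sin (π * z) = ((cexp (π * I * z))⁻¹ - cexp (π * I * z)) * I / 2 := by
      rw [Complex.sin, ← Complex.exp_neg]; ring_nf
    have a5 : Complex.sin (π * (z + τ)) =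
        ((cexp (π * I * z))⁻¹ * (cexp (π * I * τ))⁻¹ - cexp (π * I * z) * cexp (π * I * τ))
          * I / 2 := by
      rw [Complex.sin, ← Complex.exp_neg, ← Complex.exp_neg, ← Complex.exp_add, ← Complex.exp_add]
      ring_nf
    rw [a1, a2, a3, a4, a5]
    field_simp
    ring
  linear_combination qProd (cexp (2 * π * I * τ)) (cexp (2 * π * I * (z + τ))) *
    qProd (cexp (2 * π * I * τ)) (cexp (-(2 * π * I * z))) * key

/-! ### Division by the sine -/

/-- The quotient `f z / sin (π z)`, with its removable singularities filled in. -/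
noncomputable def sinQuot (f : ℂ → ℂ) (z : ℂ) : ℂ :=
  if Complex.sin (π * z) = 0 then deriv f z / (π * Complex.cos (π * z))
  else f z / Complex.sin (π * z)

lemma sin_mul_sinQuot {f : ℂ → ℂ} {z : ℂ} (h : Complex.sin (π * z) = 0 → f z = 0) :
    Complex.sin (π * z) * sinQuot f z = f z := by
  unfold sinQuot
  split_ifs with hs
  · rw [hs, zero_mul, h hs]
  · field_simp

lemma sin_pi_mul_add_one (z : ℂ) : Complex.sin (π * (z + 1)) = -Complex.sin (π * z) := by
  rw [mul_add, mul_one, Complex.sin_add_pi]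

lemma cos_pi_mul_add_one (z : ℂ) : Complex.cos (π * (z + 1)) = -Complex.cos (π * z) := by
  rw [mul_add, mul_one, Complex.cos_add_pi]

lemma sinQuot_add_one {f : ℂ → ℂ} {c : ℂ} (h : ∀ z, f (z + 1) = c * f z) (z : ℂ) :
    sinQuot f (z + 1) = -(c * sinQuot f z) := by
  have hd : deriv f (z + 1) = c * deriv f z := by
    rw [← deriv_comp_add_const, funext h, deriv_const_mul_field]
  simp only [sinQuot, sin_pi_mul_add_one, cos_pi_mul_add_one, neg_eq_zero, hd, h]
  split_ifs <;> ring

lemma sin_pi_mul_ne_zero_of_im_ne_zero {z : ℂ} (hz : z.im ≠ 0) : Complex.sin (π * z) ≠ 0 := by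
  rw [Complex.sin_ne_zero_iff]
  intro k hk
  have : z = k := by
    have : (π : ℂ) ≠ 0 := by exact_mod_cast Real.pi_ne_zero
    rw [mul_comm (k : ℂ)] at hk
    exact mul_left_cancel₀ this hk
  simp [this] at hz

lemma hasDerivAt_sin_pi_mul (z : ℂ) :
    HasDerivAt (fun z : ℂ ↦ Complex.sin (π * z)) (π * Complex.cos (π * z)) z := by
  simpa [mul_comm] using ((hasDerivAt_id z).const_mul (π : ℂ)).csin

lemma differentiableOn_sinQuot {f : ℂ → ℂ} {U : Set ℂ} (hU : IsOpen U)
    (hf : DifferentiableOn ℂ f U) (h0 : ∀ z ∈ U, Complex.sin (π * z) = 0 → f z = 0) :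
    DifferentiableOn ℂ (sinQuot f) U := by
  intro z hz
  apply DifferentiableAt.differentiableWithinAt
  have hUz : U ∈ 𝓝 z := hU.mem_nhds hz
  have hs : Differentiable ℂ fun z : ℂ ↦ Complex.sin (π * z) := by fun_prop
  by_cases hz0 : Complex.sin (π * z) = 0
  · have hd : deriv (fun z : ℂ ↦ Complex.sin (π * z)) z ≠ 0 := by
      rw [(hasDerivAt_sin_pi_mul z).deriv]
      refine mul_ne_zero (by exact_mod_cast Real.pi_ne_zero) fun hc ↦ ?_
      simpa [hz0, hc] using Complex.sin_sq_add_cos_sq (π * z)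
    have hs' : DifferentiableAt ℂ (dslope (fun z : ℂ ↦ Complex.sin (π * z)) z) z :=
      ((Complex.differentiableOn_dslope univ_mem).2 hs.differentiableOn).differentiableAt univ_mem
    have hf' : DifferentiableAt ℂ (dslope f z) z :=
      ((Complex.differentiableOn_dslope hUz).2 hf).differentiableAt hUz
    refine (hf'.div hs' (by rwa [dslope_same])).congr_of_eventuallyEq ?_
    have hne : ∀ᶠ w in 𝓝 z, dslope (fun z : ℂ ↦ Complex.sin (π * z)) z w ≠ 0 :=
      hs'.continuousAt.eventually_ne (by rwa [dslope_same])
    filter_upwards [hne] with w hw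
    rcases eq_or_ne w z with rfl | hwz
    · simp only [Pi.div_apply, dslope_same, (hasDerivAt_sin_pi_mul w).deriv]
      simp [sinQuot, hz0]
    · simp only [Pi.div_apply]
      rw [dslope_of_ne _ hwz] at hw ⊢
      rw [dslope_of_ne _ hwz]
      simp only [slope, vsub_eq_sub, smul_eq_mul, h0 z hz hz0, hz0, sub_zero] at hw ⊢
      have hw' := right_ne_zero_of_mul hw
      rw [sinQuot, if_neg hw', mul_div_mul_left _ _ (left_ne_zero_of_mul hw)]
  · have hev : ∀ᶠ w in 𝓝 z, Complex.sin (π * w) ≠ 0 :=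
      hs.continuous.continuousAt.eventually_ne hz0
    refine ((hf.differentiableAt hUz).div (hs z) hz0).congr_of_eventuallyEq ?_
    filter_upwards [hev] with w hw
    simp [sinQuot, hw]

/-! ### Period integrals of holomorphic functions on a horizontal strip -/

lemma isOpen_strip (b : ℝ) : IsOpen {z : ℂ | |z.im| < b} :=
  isOpen_lt (by fun_prop) continuous_const

lemma convex_strip (b : ℝ) : Convex ℝ {z : ℂ | |z.im| < b} := by
  have h : {z : ℂ | |z.im| < b} = Complex.imLm ⁻¹' (Set.Ioo (-b) b) := by
    ext z; simp [abs_lt]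
  rw [h]
  exact (convex_Ioo _ _).linear_preimage _

lemma continuous_comp_ofReal_add {F : ℂ → ℂ} {b : ℝ}
    (hF : DifferentiableOn ℂ F {z : ℂ | |z.im| < b}) {z : ℂ} (hz : |z.im| < b) :
    Continuous fun x : ℝ ↦ F (x + z) := by
  rw [continuous_iff_continuousAt]
  intro x
  have hx : (x + z : ℂ) ∈ {z : ℂ | |z.im| < b} := by simpa using hz
  exact ContinuousAt.comp (g := F)
    (hF.differentiableAt ((isOpen_strip b).mem_nhds hx)).continuousAt (by fun_prop)

lemma integral_ofReal_add_of_periodic {F : ℂ → ℂ} {z : ℂ}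
    (hper : ∀ x : ℝ, F (x + z + 1) = F (x + z)) (a : ℝ) :
    ∫ x in (0 : ℝ)..1, F (x + (a + z)) = ∫ x in (0 : ℝ)..1, F (x + z) := by
  have hp : Function.Periodic (fun x : ℝ ↦ F (x + z)) 1 := fun x ↦ by
    have h := hper x
    rw [add_right_comm] at h
    push_cast
    exact h
  have := hp.intervalIntegral_add_eq a 0
  rw [zero_add] at this
  rw [← this]
  have h2 := intervalIntegral.integral_comp_add_right (a := 0) (b := 1)
    (fun x : ℝ ↦ F (x + z)) a
  rw [zero_add, add_comm 1 a] at h2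
  rw [← h2]
  push_cast
  simp only [add_assoc]

lemma integral_ofReal_add_eq_of_strip {F : ℂ → ℂ} {b : ℝ}
    (hF : DifferentiableOn ℂ F {z : ℂ | |z.im| < b}) (hper : ∀ z : ℂ, F (z + 1) = F z)
    {z w : ℂ} (hz : |z.im| < b) (hw : |w.im| < b) :
    ∫ x in (0 : ℝ)..1, F (x + z) = ∫ x in (0 : ℝ)..1, F (x + w) := by
  have h (z : ℂ) : ∫ x in (0 : ℝ)..1, F (x + z) = ∫ x in (0 : ℝ)..1, F (x + z.im * I) := by
    rw [← integral_ofReal_add_of_periodic (z := z.im * I) (fun x ↦ hper _) z.re, Complex.re_add_im]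
  rw [h z, h w]
  have hc := Complex.integral_boundary_rect_eq_zero_of_differentiableOn F (z.im * I)
    (1 + w.im * I) (hF.mono fun u hu ↦ ?_)
  · have hv : ∀ y : ℝ, F (1 + y * I) = F (0 + y * I) := fun y ↦ by
      rw [zero_add, add_comm, hper]
    simp only [add_re, mul_re, ofReal_re, ofReal_im, I_re, I_im, one_re, add_im, mul_im, one_im,
      mul_zero, mul_one, sub_zero, zero_add, add_zero, ofReal_zero, ofReal_one] at hc
    simp only [hv, zero_add] at hc
    linear_combination hc
  · obtain ⟨-, hu⟩ := hu
    simp only [add_im, mul_im, ofReal_re, ofReal_im, I_re, I_im, one_im, mul_zero, mul_one,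
      zero_add, add_zero, mem_preimage] at hu
    rw [mem_ofPred_eq, abs_lt] at *
    rcases Set.mem_uIcc.1 hu with h | h <;> constructor <;> linarith [h.1, h.2]

/-! ### The period integral of the cotangent -/

lemma pi_mul_cot_eq {z : ℂ} (hz : 0 < z.im) :
    π * (Complex.cos (π * z) / Complex.sin (π * z)) =
      -(π * I) + -(2 * π * I * cexp (2 * π * I * z)) / (1 - cexp (2 * π * I * z)) := by
  have hs := sin_pi_mul_ne_zero_of_im_ne_zero hz.ne'
  have h1 : 1 - cexp (2 * π * I * z) ≠ 0 := fun h ↦ by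
    have := norm_cexp_two_pi_I_mul_lt_one hz
    rw [← sub_eq_zero.1 h] at this
    simp at this
  have he := Complex.exp_ne_zero (π * z * I)
  have e1 : cexp (2 * π * I * z) = cexp (π * z * I) ^ 2 := by
    rw [← Complex.exp_nat_mul]; congr 1; push_cast; ring
  have e2 : Complex.cos (π * z) = (cexp (π * z * I) + (cexp (π * z * I))⁻¹) / 2 := by
    rw [Complex.cos, ← Complex.exp_neg, neg_mul]
  have e3 : Complex.sin (π * z) = ((cexp (π * z * I))⁻¹ - cexp (π * z * I)) * I / 2 := by
    rw [Complex.sin, ← Complex.exp_neg, neg_mul]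
  have e4 : (cexp (π * z * I))⁻¹ - cexp (π * z * I) ≠ 0 := fun h ↦ hs (by rw [e3, h]; simp)
  rw [e1] at h1
  rw [e1, e2, e3]
  have hI := I_ne_zero
  generalize cexp (π * z * I) = e at *
  have e5 : e⁻¹ - e = (1 - e ^ 2) / e := by field_simp
  rw [e5]
  field_simp
  rw [I_sq]
  ring

lemma integral_pi_mul_cot_of_im_pos {z : ℂ} (hz : 0 < z.im) :
    ∫ x in (0 : ℝ)..1, π * (Complex.cos (π * (x + z)) / Complex.sin (π * (x + z))) =
      -(π * I) := by
  have hxz (x : ℝ) : 0 < (x + z : ℂ).im := by simpa using hz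
  have hder (x : ℝ) (_ : x ∈ Set.uIcc (0 : ℝ) 1) :
      HasDerivAt (fun x : ℝ ↦ -(π * I) * (x : ℂ) + Complex.log (1 - cexp (2 * π * I * (x + z))))
        (π * (Complex.cos (π * (x + z)) / Complex.sin (π * (x + z)))) x := by
    rw [pi_mul_cot_eq (hxz x)]
    have hslit : 1 - cexp (2 * π * I * (x + z)) ∈ slitPlane := by
      left
      have h1 := (Complex.re_le_norm (cexp (2 * π * I * (x + z)))).trans_lt
        (norm_cexp_two_pi_I_mul_lt_one (hxz x))
      rw [sub_re, one_re]
      linarith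
    have hx' : HasDerivAt (fun x : ℝ ↦ (x : ℂ)) 1 x := (hasDerivAt_id x).ofReal_comp
    have h2 := ((((hx'.add_const z).const_mul (2 * π * I)).cexp).const_sub 1).clog_real hslit
    have h3 := (hx'.const_mul (-(π * I))).add h2
    refine h3.congr_deriv ?_
    rw [mul_one, mul_one]
    ring
  have hcont : Continuous fun x : ℝ ↦
      π * (Complex.cos (π * (x + z)) / Complex.sin (π * (x + z))) := by
    refine continuous_const.mul (Continuous.div (by fun_prop) (by fun_prop) fun x ↦ ?_)
    exact sin_pi_mul_ne_zero_of_im_ne_zero (hxz x).ne'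
  rw [intervalIntegral.integral_eq_sub_of_hasDerivAt hder (hcont.intervalIntegrable _ _)]
  have hp : cexp (2 * π * I * ((1 : ℝ) + z)) = cexp (2 * π * I * ((0 : ℝ) + z)) := by
    simp [mul_add, Complex.exp_add, Complex.exp_two_pi_mul_I]
  rw [hp]
  simp

lemma integral_odd_neg {F : ℂ → ℂ} (hper : ∀ z, F (z + 1) = F z) (hodd : ∀ z, F (-z) = -F z)
    (z : ℂ) : ∫ x in (0 : ℝ)..1, F (x + -z) = -∫ x in (0 : ℝ)..1, F (x + z) := by
  rw [← intervalIntegral.integral_neg]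
  have h := intervalIntegral.integral_comp_sub_left (a := 0) (b := 1) (fun x : ℝ ↦ F (x + -z)) 1
  rw [sub_self, sub_zero] at h
  rw [← h]
  congr 1
  ext x
  rw [← hodd, ← hper (-(x + z))]
  push_cast
  ring_nf

lemma integral_pi_mul_cot_of_im_neg {z : ℂ} (hz : z.im < 0) :
    ∫ x in (0 : ℝ)..1, π * (Complex.cos (π * (x + z)) / Complex.sin (π * (x + z))) = π * I := by
  have h := integral_odd_neg (F := fun z ↦ π * (Complex.cos (π * z) / Complex.sin (π * z)))
    (fun z ↦ by simp only [sin_pi_mul_add_one, cos_pi_mul_add_one, neg_div_neg_eq])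
    (fun z ↦ by simp only [mul_neg, Complex.sin_neg, Complex.cos_neg, div_neg]) (-z)
  rw [neg_neg] at h
  rw [h, integral_pi_mul_cot_of_im_pos (by simpa using hz), neg_neg]

/-! ### The product formula for `theta1` on the strip `|Im z| < Im τ` -/

lemma eq_zero_of_sin_eq_zero {f : ℂ → ℂ} (h0 : f 0 = 0) (h : ∀ z, f (z + 1) = 0 ↔ f z = 0)
    {z : ℂ} (hz : Complex.sin (π * z) = 0) : f z = 0 := by
  have hint (n : ℤ) : f n = 0 := by
    induction n using Int.induction_on with
    | zero => simpa using h0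
    | succ n ih => rw [Int.cast_add, Int.cast_one, h]; exact ih
    | pred n ih => rw [← h, Int.cast_sub, Int.cast_one, sub_add_cancel]; exact ih
  obtain ⟨k, hk⟩ := Complex.sin_eq_zero_iff.1 hz
  have hpi : (π : ℂ) ≠ 0 := by exact_mod_cast Real.pi_ne_zero
  rw [mul_comm (k : ℂ)] at hk
  rw [mul_left_cancel₀ hpi hk]
  exact hint k

lemma theta1_eq_zero_of_sin_eq_zero {τ z : ℂ} (hz : Complex.sin (π * z) = 0) :
    theta1 τ z = 0 := by
  refine eq_zero_of_sin_eq_zero ?_ (fun z ↦ ?_) hz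
  · have h := theta1_neg τ 0
    rw [neg_zero] at h
    exact self_eq_neg.1 h
  · rw [theta1_add_one, neg_eq_zero]

lemma isPreconnected_strip (b : ℝ) : IsPreconnected {z : ℂ | |z.im| < b} :=
  (convex_strip b).isPreconnected

lemma exists_theta1_eq_mul {τ : ℂ} (hτ : 0 < τ.im) :
    ∃ C : ℂ, ∀ z : ℂ, |z.im| < τ.im →
      theta1 τ z = C * (Complex.sin (π * z) * thetaFactor τ z) := by
  set E : ℂ → ℂ := fun z ↦ sinQuot (theta1 τ) z / thetaFactor τ z with hE
  have hmul {z : ℂ} (hz : |z.im| < τ.im) :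
      theta1 τ z = E z * (Complex.sin (π * z) * thetaFactor τ z) := by
    rw [← sin_mul_sinQuot (f := theta1 τ) (z := z) theta1_eq_zero_of_sin_eq_zero]
    have := thetaFactor_ne_zero hz
    simp only [hE]
    field_simp
  have hd : DifferentiableOn ℂ E {z : ℂ | |z.im| < τ.im} :=
    (differentiableOn_sinQuot (isOpen_strip _) (differentiable_theta1 hτ).differentiableOn
      fun z _ ↦ theta1_eq_zero_of_sin_eq_zero).div
      (differentiable_thetaFactor hτ).differentiableOn fun z hz ↦ thetaFactor_ne_zero hz
  have hone : Function.Periodic E 1 := fun z ↦ by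
    simp only [hE, thetaFactor_add_one]
    rw [sinQuot_add_one (c := -1) fun z ↦ by rw [theta1_add_one, neg_one_mul]]
    ring
  have htau {z : ℂ} (h1 : -τ.im < z.im) (h2 : z.im < 0) : E (z + τ) = E z := by
    have hz : |z.im| < τ.im := by rw [abs_lt]; constructor <;> linarith
    have hz' : |(z + τ).im| < τ.im := by rw [add_im, abs_lt]; constructor <;> linarith
    have hs := sin_pi_mul_ne_zero_of_im_ne_zero h2.ne
    have hs' := sin_pi_mul_ne_zero_of_im_ne_zero (z := z + τ) (by rw [add_im]; linarith)
    have h3 := hmul hz'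
    rw [theta1_add_self, sin_mul_thetaFactor_add_self hτ, hmul hz] at h3
    have hne : -cexp (-(π * I * (τ + 2 * z))) * (Complex.sin (π * z) * thetaFactor τ z) ≠ 0 :=
      mul_ne_zero (neg_ne_zero.2 (Complex.exp_ne_zero _)) (mul_ne_zero hs (thetaFactor_ne_zero hz))
    refine mul_right_cancel₀ hne ?_
    rw [← h3]
    ring
  set K : Set ℂ := Set.Icc (0 : ℝ) 1 ×ℂ Set.Icc (-(τ.im / 2)) (τ.im / 2) with hK
  have hred {z : ℂ} (hz : |z.im| < τ.im) : ∃ w ∈ K, E w = E z := by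
    have hred' {z : ℂ} (hz : z.im ∈ Set.Icc (-(τ.im / 2)) (τ.im / 2)) : ∃ w ∈ K, E w = E z := by
      refine ⟨z - (⌊z.re⌋ : ℂ), ⟨⟨?_, ?_⟩, ?_⟩, ?_⟩
      · simp
      · simpa using (Int.fract_lt_one z.re).le
      · simpa using hz
      · simpa using hone.sub_int_mul_eq (x := z) ⌊z.re⌋
    rw [abs_lt] at hz
    rcases lt_or_ge z.im (-(τ.im / 2)) with h | h
    · rw [← htau hz.1 (by linarith)]
      exact hred' (by rw [add_im]; constructor <;> linarith)
    · rcases le_or_gt z.im (τ.im / 2) with h' | h'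
      · exact hred' ⟨h, h'⟩
      · have h4 := htau (z := z - τ) (by rw [sub_im]; linarith) (by rw [sub_im]; linarith)
        rw [sub_add_cancel] at h4
        rw [h4]
        exact hred' (by rw [sub_im]; constructor <;> linarith)
  have hKS : K ⊆ {z : ℂ | |z.im| < τ.im} := fun z hz ↦ by
    have h := hz.2
    rw [mem_preimage, Set.mem_Icc] at h
    rw [mem_ofPred_eq, abs_lt]
    constructor <;> linarith [h.1, h.2]
  have hKne : K.Nonempty := ⟨0, by simpa [hK, Complex.mem_reProdIm] using (half_pos hτ).le⟩
  obtain ⟨c, hcK, hc⟩ := (isCompact_Icc.reProdIm isCompact_Icc).exists_isMaxOn hKne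
    (hd.continuousOn.mono hKS).norm
  have hmax : IsMaxOn (norm ∘ E) {z : ℂ | |z.im| < τ.im} c := fun z hz ↦ by
    obtain ⟨w, hwK, hw⟩ := hred hz
    have := hc hwK
    simp only [mem_ofPred_eq, Function.comp_apply] at this ⊢
    rwa [← hw]
  refine ⟨E c, fun z hz ↦ ?_⟩
  rw [hmul hz, Complex.eqOn_of_isPreconnected_of_isMaxOn_norm (isPreconnected_strip _)
    (isOpen_strip _) hd (hKS hcK) hmax hz]
  rfl

lemma exists_theta1_eq_sin_mul {τ w : ℂ} (hτ : 0 < τ.im) (hw : |w.im| < τ.im)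
    (hne : theta1 τ w ≠ 0) :
    ∃ V : ℂ → ℂ, Differentiable ℂ V ∧ (∀ z, V (z + 1) = V z) ∧ (∀ z, V (-z) = V z) ∧
      (∀ z : ℂ, |z.im| < τ.im → V z ≠ 0) ∧
      ∀ z : ℂ, |z.im| < τ.im → theta1 τ z = Complex.sin (π * z) * V z := by
  obtain ⟨C, hC⟩ := exists_theta1_eq_mul hτ
  have hC0 : C ≠ 0 := left_ne_zero_of_mul (hC w hw ▸ hne)
  refine ⟨fun z ↦ C * thetaFactor τ z, (differentiable_thetaFactor hτ).const_mul C, fun z ↦ ?_,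
    fun z ↦ ?_, fun z hz ↦ mul_ne_zero hC0 (thetaFactor_ne_zero hz), fun z hz ↦ ?_⟩
  · simp only [thetaFactor_add_one]
  · simp only [thetaFactor_neg]
  · rw [hC z hz]
    ring

/-! ### Derivatives of `theta1` -/

lemma differentiable_deriv_theta1 {τ : ℂ} (hτ : 0 < τ.im) :
    Differentiable ℂ (deriv (theta1 τ)) := (differentiable_theta1 hτ).deriv

lemma deriv_theta1_add_one (τ z : ℂ) : deriv (theta1 τ) (z + 1) = -deriv (theta1 τ) z := by
  rw [← deriv_comp_add_const, funext (theta1_add_one τ), deriv.fun_neg]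

lemma deriv_deriv_theta1_add_one (τ z : ℂ) :
    deriv (deriv (theta1 τ)) (z + 1) = -deriv (deriv (theta1 τ)) z := by
  rw [← deriv_comp_add_const, funext (deriv_theta1_add_one τ), deriv.fun_neg]

lemma deriv_theta1_neg (τ z : ℂ) : deriv (theta1 τ) (-z) = deriv (theta1 τ) z := by
  have h : deriv (fun z ↦ theta1 τ (-z)) z = deriv (fun z ↦ -theta1 τ z) z := by
    rw [funext (theta1_neg τ)]
  rw [deriv_comp_neg, deriv.fun_neg, neg_inj] at h
  exact h

lemma deriv_deriv_theta1_zero (τ : ℂ) : deriv (deriv (theta1 τ)) 0 = 0 := by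
  have h : deriv (fun z ↦ deriv (theta1 τ) (-z)) 0 = deriv (deriv (theta1 τ)) 0 := by
    rw [funext (deriv_theta1_neg τ)]
  rw [deriv_comp_neg, neg_zero] at h
  exact self_eq_neg.1 h.symm

lemma hasDerivAt_multiplier (τ z : ℂ) :
    HasDerivAt (fun z ↦ -cexp (-(π * I * (τ + 2 * z))))
      (-cexp (-(π * I * (τ + 2 * z))) * -(2 * π * I)) z := by
  have h := ((((((hasDerivAt_id z).const_mul 2).const_add τ).const_mul (π * I)).neg).cexp).neg
  refine h.congr_deriv ?_
  simp only [id, Pi.neg_apply]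
  ring

lemma deriv_theta1_add_self {τ : ℂ} (hτ : 0 < τ.im) (z : ℂ) :
    deriv (theta1 τ) (z + τ) = -cexp (-(π * I * (τ + 2 * z))) *
      (deriv (theta1 τ) z - 2 * π * I * theta1 τ z) := by
  rw [← deriv_comp_add_const, funext (theta1_add_self τ),
    ((hasDerivAt_multiplier τ z).fun_mul (differentiable_theta1 hτ z).hasDerivAt).deriv]
  ring

lemma deriv_deriv_theta1_add_self {τ : ℂ} (hτ : 0 < τ.im) (z : ℂ) :
    deriv (deriv (theta1 τ)) (z + τ) = -cexp (-(π * I * (τ + 2 * z))) *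
      (deriv (deriv (theta1 τ)) z - 2 * (2 * π * I) * deriv (theta1 τ) z +
        (2 * π * I) ^ 2 * theta1 τ z) := by
  rw [← deriv_comp_add_const, funext (deriv_theta1_add_self hτ),
    ((hasDerivAt_multiplier τ z).fun_mul ((differentiable_deriv_theta1 hτ z).hasDerivAt.fun_sub
      ((differentiable_theta1 hτ z).hasDerivAt.const_mul (2 * π * I)))).deriv]
  ring

lemma logDeriv_theta1_add_self {τ z : ℂ} (hτ : 0 < τ.im) (hz : theta1 τ z ≠ 0) :
    deriv (theta1 τ) (z + τ) / theta1 τ (z + τ) =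
      deriv (theta1 τ) z / theta1 τ z - 2 * π * I := by
  rw [deriv_theta1_add_self hτ, theta1_add_self, mul_div_mul_left _ _
    (neg_ne_zero.2 (Complex.exp_ne_zero _)), sub_div, mul_div_assoc, div_self hz, mul_one]

lemma deriv_deriv_theta1_div_add_self {τ z : ℂ} (hτ : 0 < τ.im) (hz : theta1 τ z ≠ 0) :
    deriv (deriv (theta1 τ)) (z + τ) / theta1 τ (z + τ) =
      deriv (deriv (theta1 τ)) z / theta1 τ z -
        2 * (2 * π * I) * (deriv (theta1 τ) z / theta1 τ z) + (2 * π * I) ^ 2 := by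
  rw [deriv_deriv_theta1_add_self hτ, theta1_add_self, mul_div_mul_left _ _
    (neg_ne_zero.2 (Complex.exp_ne_zero _))]
  field_simp

/-! ### Period integrals of the logarithmic derivative of `theta1` -/

lemma continuous_comp_ofReal_add_div {f g : ℂ → ℂ} (hf : Differentiable ℂ f)
    (hg : Differentiable ℂ g) {z : ℂ} (h : ∀ x : ℝ, g (x + z) ≠ 0) :
    Continuous fun x : ℝ ↦ f (x + z) / g (x + z) :=
  (hf.continuous.comp (by fun_prop)).div (hg.continuous.comp (by fun_prop)) h

lemma integral_deriv_deriv_theta1_div {τ z : ℂ} (hτ : 0 < τ.im)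
    (hne : ∀ x : ℝ, theta1 τ (x + z) ≠ 0) :
    ∫ x in (0 : ℝ)..1, deriv (deriv (theta1 τ)) (x + z) / theta1 τ (x + z) =
      ∫ x in (0 : ℝ)..1, (deriv (theta1 τ) (x + z) / theta1 τ (x + z)) ^ 2 := by
  have hθ := differentiable_theta1 hτ
  have hθ' := differentiable_deriv_theta1 hτ
  have hc1 := continuous_comp_ofReal_add_div hθ'.deriv hθ hne
  have hcL := continuous_comp_ofReal_add_div hθ' hθ hne
  have hc2 : Continuous fun x : ℝ ↦ (deriv (theta1 τ) (x + z) / theta1 τ (x + z)) ^ 2 :=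
    hcL.pow 2
  rw [← sub_eq_zero, ← intervalIntegral.integral_sub (hc1.intervalIntegrable _ _)
    (hc2.intervalIntegrable _ _)]
  have hder (x : ℝ) (_ : x ∈ Set.uIcc (0 : ℝ) 1) :
      HasDerivAt (fun x : ℝ ↦ deriv (theta1 τ) (x + z) / theta1 τ (x + z))
        (deriv (deriv (theta1 τ)) (x + z) / theta1 τ (x + z) -
          (deriv (theta1 τ) (x + z) / theta1 τ (x + z)) ^ 2) x := by
    have hx : HasDerivAt (fun x : ℝ ↦ (x : ℂ) + z) 1 x :=
      (hasDerivAt_id x).ofReal_comp.add_const z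
    have h := ((hθ' (x + z)).hasDerivAt.div (hθ (x + z)).hasDerivAt (hne x)).comp x hx
    refine h.congr_deriv ?_
    have := hne x
    field_simp
  rw [intervalIntegral.integral_eq_sub_of_hasDerivAt hder ((hc1.sub hc2).intervalIntegrable _ _)]
  simp only [ofReal_one, ofReal_zero, zero_add, add_comm 1 z, theta1_add_one, deriv_theta1_add_one,
    neg_div_neg_eq, sub_self]

lemma logDeriv_eq_cot_add {θ V : ℂ → ℂ} {b : ℝ} (hV : Differentiable ℂ V)
    (hV0 : ∀ z : ℂ, |z.im| < b → V z ≠ 0)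
    (hθ : ∀ z : ℂ, |z.im| < b → θ z = Complex.sin (π * z) * V z) {z : ℂ} (hz : |z.im| < b)
    (hz0 : z.im ≠ 0) :
    deriv θ z / θ z = π * (Complex.cos (π * z) / Complex.sin (π * z)) + deriv V z / V z := by
  have hev : θ =ᶠ[𝓝 z] fun z ↦ Complex.sin (π * z) * V z := by
    filter_upwards [(isOpen_strip b).mem_nhds hz] with w hw using hθ w hw
  rw [hev.deriv_eq, ((hasDerivAt_sin_pi_mul z).fun_mul (hV z).hasDerivAt).deriv, hθ z hz]
  have := hV0 z hz
  have := sin_pi_mul_ne_zero_of_im_ne_zero hz0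
  field_simp

lemma integral_logDeriv_eq_zero_of_even {V : ℂ → ℂ} {b : ℝ} (hV : Differentiable ℂ V)
    (hV1 : ∀ z, V (z + 1) = V z) (hVe : ∀ z, V (-z) = V z)
    (hV0 : ∀ z : ℂ, |z.im| < b → V z ≠ 0) {z : ℂ} (hz : |z.im| < b) :
    ∫ x in (0 : ℝ)..1, deriv V (x + z) / V (x + z) = 0 := by
  have hper (z : ℂ) : deriv V (z + 1) / V (z + 1) = deriv V z / V z := by
    rw [← deriv_comp_add_const, funext hV1, hV1]
  have hodd (z : ℂ) : deriv V (-z) / V (-z) = -(deriv V z / V z) := by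
    have h : deriv (fun z ↦ V (-z)) z = deriv V z := by rw [funext hVe]
    rw [deriv_comp_neg] at h
    rw [hVe, ← h]
    ring
  have h1 := integral_odd_neg (F := fun z ↦ deriv V z / V z) hper hodd z
  have h2 := integral_ofReal_add_eq_of_strip (F := fun z ↦ deriv V z / V z) (b := b)
    (hV.deriv.differentiableOn.div hV.differentiableOn hV0) hper hz (w := -z) (by simpa using hz)
  rw [← h2] at h1
  exact self_eq_neg.1 h1

/-- The period integral of `(θ''/θ) (θ'/θ)` jumps by `2πi θ'''(0)/θ'(0)` across the real axis. -/
lemma integral_theta1_jump {τ : ℂ} (hτ : 0 < τ.im) {V : ℂ → ℂ} (hV : Differentiable ℂ V)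
    (hV1 : ∀ z, V (z + 1) = V z) (hV0 : ∀ z : ℂ, |z.im| < τ.im → V z ≠ 0)
    (hθV : ∀ z : ℂ, |z.im| < τ.im → theta1 τ z = Complex.sin (π * z) * V z)
    {z w : ℂ} (hz : |z.im| < τ.im) (hz0 : 0 < z.im) (hw : |w.im| < τ.im) (hw0 : w.im < 0) :
    (∫ x in (0 : ℝ)..1, deriv (deriv (theta1 τ)) (x + w) / theta1 τ (x + w) *
        (deriv (theta1 τ) (x + w) / theta1 τ (x + w))) -
      (∫ x in (0 : ℝ)..1, deriv (deriv (theta1 τ)) (x + z) / theta1 τ (x + z) *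
        (deriv (theta1 τ) (x + z) / theta1 τ (x + z))) =
      2 * π * I * (iteratedDeriv 3 (theta1 τ) 0 / deriv (theta1 τ) 0) := by
  have hθ := differentiable_theta1 hτ
  have hθ' := differentiable_deriv_theta1 hτ
  have hpi : (π : ℂ) ≠ 0 := by exact_mod_cast Real.pi_ne_zero
  have h0S : |(0 : ℂ).im| < τ.im := by simpa using hτ
  have hsin {z : ℂ} (hz : Complex.sin (π * z) = 0) : deriv (deriv (theta1 τ)) z = 0 :=
    eq_zero_of_sin_eq_zero (deriv_deriv_theta1_zero τ)
      (fun z ↦ by rw [deriv_deriv_theta1_add_one, neg_eq_zero]) hz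
  set h : ℂ → ℂ := fun z ↦ sinQuot (deriv (deriv (theta1 τ))) z / V z with hh
  have hd : DifferentiableOn ℂ h {z : ℂ | |z.im| < τ.im} :=
    (differentiableOn_sinQuot (isOpen_strip _) hθ'.deriv.differentiableOn fun z _ ↦ hsin).div
      hV.differentiableOn hV0
  have h1 (z : ℂ) : h (z + 1) = h z := by
    simp only [hh, hV1]
    rw [sinQuot_add_one (c := -1) fun z ↦ by rw [deriv_deriv_theta1_add_one, neg_one_mul]]
    ring
  have hmul {z : ℂ} (hz : |z.im| < τ.im) : deriv (deriv (theta1 τ)) z = h z * theta1 τ z := by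
    rw [← sin_mul_sinQuot (f := deriv (deriv (theta1 τ))) (z := z) hsin, hθV z hz]
    have := hV0 z hz
    simp only [hh]
    field_simp
  have hval : iteratedDeriv 3 (theta1 τ) 0 / deriv (theta1 τ) 0 = h 0 := by
    have hev : deriv (deriv (theta1 τ)) =ᶠ[𝓝 0] fun z ↦ h z * theta1 τ z := by
      filter_upwards [(isOpen_strip τ.im).mem_nhds h0S] with w hw using hmul hw
    have hev' : theta1 τ =ᶠ[𝓝 0] fun z ↦ Complex.sin (π * z) * V z := by
      filter_upwards [(isOpen_strip τ.im).mem_nhds h0S] with w hw using hθV w hw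
    have hne : deriv (theta1 τ) 0 ≠ 0 := by
      rw [hev'.deriv_eq, ((hasDerivAt_sin_pi_mul 0).fun_mul (hV 0).hasDerivAt).deriv]
      simpa [hpi] using hV0 0 h0S
    have ht : theta1 τ 0 = 0 := theta1_eq_zero_of_sin_eq_zero (by simp)
    rw [iteratedDeriv_succ, iteratedDeriv_succ, iteratedDeriv_one, hev.deriv_eq,
      ((hd.differentiableAt ((isOpen_strip τ.im).mem_nhds h0S)).hasDerivAt.fun_mul
        (hθ 0).hasDerivAt).deriv, ht]
    field_simp
    ring
  set R : ℂ → ℂ := fun z ↦ π * Complex.cos (π * z) * sinQuot (fun z ↦ h z - h 0) z +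
    h z * (deriv V z / V z) with hR
  have hsin' {z : ℂ} (hz : Complex.sin (π * z) = 0) : h z - h 0 = 0 :=
    eq_zero_of_sin_eq_zero (f := fun z ↦ h z - h 0) (sub_self _)
      (fun z ↦ by simp only [h1]) hz
  have hRd : DifferentiableOn ℂ R {z : ℂ | |z.im| < τ.im} := by
    refine DifferentiableOn.add (DifferentiableOn.mul (by fun_prop) ?_)
      (hd.mul (hV.deriv.differentiableOn.div hV.differentiableOn hV0))
    exact differentiableOn_sinQuot (isOpen_strip _) (hd.sub_const _) fun z _ ↦ hsin'
  have hR1 (z : ℂ) : R (z + 1) = R z := by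
    simp only [hR, h1, hV1, cos_pi_mul_add_one]
    rw [sinQuot_add_one (c := 1) fun z ↦ by rw [h1, one_mul], ← deriv_comp_add_const, funext hV1]
    ring
  have hint {z : ℂ} (hz : |z.im| < τ.im) (hz0 : z.im ≠ 0) :
      (∫ x in (0 : ℝ)..1, deriv (deriv (theta1 τ)) (x + z) / theta1 τ (x + z) *
        (deriv (theta1 τ) (x + z) / theta1 τ (x + z))) =
      (∫ x in (0 : ℝ)..1, R (x + z)) + h 0 *
        ∫ x in (0 : ℝ)..1, π * (Complex.cos (π * (x + z)) / Complex.sin (π * (x + z))) := by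
    have hxz (x : ℝ) : |(x + z : ℂ).im| < τ.im := by simpa using hz
    have hs (x : ℝ) : Complex.sin (π * (x + z)) ≠ 0 :=
      sin_pi_mul_ne_zero_of_im_ne_zero (by simpa using hz0)
    have hc : Continuous fun x : ℝ ↦
        h 0 * (π * (Complex.cos (π * (x + z)) / Complex.sin (π * (x + z)))) :=
      continuous_const.mul (continuous_const.mul (Continuous.div (by fun_prop) (by fun_prop) hs))
    rw [← intervalIntegral.integral_const_mul, ← intervalIntegral.integral_add
      ((continuous_comp_ofReal_add hRd hz).intervalIntegrable _ _) (hc.intervalIntegrable _ _)]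
    congr 1
    ext x
    have hne : theta1 τ (x + z) ≠ 0 := by
      rw [hθV _ (hxz x)]
      exact mul_ne_zero (hs x) (hV0 _ (hxz x))
    rw [logDeriv_eq_cot_add hV hV0 hθV (hxz x) (by simpa using hz0), hmul (hxz x),
      mul_div_cancel_right₀ _ hne]
    have hq := sin_mul_sinQuot (f := fun z ↦ h z - h 0) (z := x + z) hsin'
    have hq' : sinQuot (fun z ↦ h z - h 0) (x + z) =
        (h (x + z) - h 0) / Complex.sin (π * (x + z)) := by
      rw [eq_div_iff (hs x), mul_comm, hq]
    simp only [hR]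
    rw [hq']
    ring
  rw [hint hz hz0.ne', hint hw hw0.ne, integral_ofReal_add_eq_of_strip hRd hR1 hw hz, hval,
    integral_pi_mul_cot_of_im_pos hz0, integral_pi_mul_cot_of_im_neg hw0]
  ring

/-- The a-cycle integral of the squared logarithmic derivative of θ₁:
∫₀¹ (θ₁'(x+iy₀|τ)/θ₁(x+iy₀|τ))² dx = θ₁'''(0|τ)/(3θ₁'(0|τ)) − 2π²/3. -/
theorem acycle_integral_log_deriv_theta1_sq (τ : ℂ) (hτ : 0 < τ.im) (y₀ : ℝ)
    (hy₀ : 0 < y₀) (hy₀' : y₀ < τ.im)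
    (hne : ∀ x : ℝ, x ∈ Set.Icc (0 : ℝ) 1 → theta1 τ ((x : ℂ) + (y₀ : ℂ) * Complex.I) ≠ 0) :
    ∫ x in (0 : ℝ)..1,
        (theta1' τ ((x : ℂ) + (y₀ : ℂ) * Complex.I) /
          theta1 τ ((x : ℂ) + (y₀ : ℂ) * Complex.I)) ^ 2 =
      iteratedDeriv 3 (theta1 τ) 0 / (3 * theta1' τ 0) - 2 * (π : ℂ) ^ 2 / 3 := by
  simp only [theta1']
  have hne0 := hne 0 (by simp)
  rw [ofReal_zero, zero_add] at hne0
  set z : ℂ := y₀ * I with hzdef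
  have hzim : z.im = y₀ := by simp [hzdef]
  have hz : |z.im| < τ.im := by rwa [hzim, abs_of_pos hy₀]
  have hw : |(z - τ).im| < τ.im := by
    rw [sub_im, hzim, abs_lt]; constructor <;> linarith
  obtain ⟨V, hV, hV1, hVe, hV0, hθV⟩ := exists_theta1_eq_sin_mul hτ hz hne0
  have hne' {u : ℂ} (hu : |u.im| < τ.im) (hu0 : u.im ≠ 0) : theta1 τ u ≠ 0 := by
    rw [hθV u hu]
    exact mul_ne_zero (sin_pi_mul_ne_zero_of_im_ne_zero hu0) (hV0 u hu)
  have hxz (x : ℝ) : |(x + z : ℂ).im| < τ.im := by simpa using hz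
  have hxz0 (x : ℝ) : (x + z : ℂ).im ≠ 0 := by
    rw [add_im, ofReal_im, zero_add, hzim]; exact hy₀.ne'
  have hneT (x : ℝ) : theta1 τ (x + z) ≠ 0 := hne' (hxz x) (hxz0 x)
  have hneB (x : ℝ) : theta1 τ (x + (z - τ)) ≠ 0 := by
    refine hne' (by simpa using hw) ?_
    rw [add_im, ofReal_im, zero_add, sub_im, hzim]
    linarith
  have hθ := differentiable_theta1 hτ
  have hθ' := differentiable_deriv_theta1 hτ
  have hcL := continuous_comp_ofReal_add_div hθ' hθ hneT
  have hcH := continuous_comp_ofReal_add_div hθ'.deriv hθ hneT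
  have hL : ∫ x in (0 : ℝ)..1, deriv (theta1 τ) (x + z) / theta1 τ (x + z) = -(π * I) := by
    have hc1 : Continuous fun x : ℝ ↦
        π * (Complex.cos (π * (x + z)) / Complex.sin (π * (x + z))) :=
      continuous_const.mul (Continuous.div (by fun_prop) (by fun_prop)
        fun x ↦ sin_pi_mul_ne_zero_of_im_ne_zero (hxz0 x))
    have hc2 := continuous_comp_ofReal_add_div hV.deriv hV fun x ↦ hV0 _ (hxz x)
    simp only [logDeriv_eq_cot_add hV hV0 hθV (hxz _) (hxz0 _)]
    rw [intervalIntegral.integral_add (hc1.intervalIntegrable _ _) (hc2.intervalIntegrable _ _),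
      integral_logDeriv_eq_zero_of_even hV hV1 hVe hV0 hz,
      integral_pi_mul_cot_of_im_pos (by rwa [hzim]), add_zero]
  have hH := integral_deriv_deriv_theta1_div hτ hneT
  have hjump := integral_theta1_jump hτ hV hV1 hV0 hθV hz (by rwa [hzim]) hw
    (by rw [sub_im, hzim]; linarith)
  have hbot (x : ℝ) : deriv (deriv (theta1 τ)) (x + (z - τ)) / theta1 τ (x + (z - τ)) *
      (deriv (theta1 τ) (x + (z - τ)) / theta1 τ (x + (z - τ))) =
      deriv (deriv (theta1 τ)) (x + z) / theta1 τ (x + z) *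
        (deriv (theta1 τ) (x + z) / theta1 τ (x + z)) +
      (2 * π * I) * (deriv (deriv (theta1 τ)) (x + z) / theta1 τ (x + z)) +
      2 * (2 * π * I) * (deriv (theta1 τ) (x + z) / theta1 τ (x + z)) ^ 2 +
      3 * (2 * π * I) ^ 2 * (deriv (theta1 τ) (x + z) / theta1 τ (x + z)) +
      (2 * π * I) ^ 3 := by
    have e : (x : ℂ) + z = x + (z - τ) + τ := by ring
    rw [e, logDeriv_theta1_add_self hτ (hneB x), deriv_deriv_theta1_div_add_self hτ (hneB x)]
    ring
  simp only [hbot] at hjump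
  rw [intervalIntegral.integral_add, intervalIntegral.integral_add, intervalIntegral.integral_add,
    intervalIntegral.integral_add, intervalIntegral.integral_const_mul,
    intervalIntegral.integral_const_mul, intervalIntegral.integral_const_mul, hL, hH,
    intervalIntegral.integral_const] at hjump
  · have hpi : (π : ℂ) ≠ 0 := by exact_mod_cast Real.pi_ne_zero
    have h2pi : 2 * π * I ≠ 0 := by simp [hpi]
    rw [mul_comm 3 (deriv (theta1 τ) 0), ← div_div]
    rw [sub_zero, one_smul] at hjump
    have h3 := mul_left_cancel₀ h2pi (b := iteratedDeriv 3 (theta1 τ) 0 / deriv (theta1 τ) 0)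
      (c := 3 * (∫ x in (0 : ℝ)..1, (deriv (theta1 τ) (x + z) / theta1 τ (x + z)) ^ 2) -
        (2 * π * I) ^ 2 / 2) (by rw [← hjump]; ring)
    rw [h3]
    linear_combination (2 / 3 : ℂ) * π ^ 2 * I_sq
  all_goals exact Continuous.intervalIntegrable (by fun_prop) _ _
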